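/- arXiv:1908.09761 — 4 statements merged into one kernel-verified Lean document; each statement's English description precedes it below -/
import Mathlib

section
/- Let D ≥ 1, let U ∈ M_D(ℂ) be a unitary matrix with columns v_0,…,v_{D−1}, and let θ : Fin D → ℝ satisfy θ_i > 0 for all i and Σ_i θ_i² = 1. Define σ := Σ_i θ_i² · v_i v_iᴴ, R₁ := Σ_{i : i+1 < D} θ_i · v_i v_{i+1}ᴴ, R₂ := Σ_{i : i+1 < D} θ_{i+1} · v_{i+1} v_iᴴ, and Q := −(1/2)·(R₁ᴴ*R₁ + R₂ᴴ*R₂). Then for every ρ ∈ M_D(ℂ): Q*ρ + ρ*Qᴴ + R₁*ρ*R₁ᴴ + R₂*ρ*R₂ᴴ = 0 if and only if there exists c ∈ ℂ with ρ = c • σ. -/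
/-- Shift a finite sequence by one place and extend it by zero to all of `ℕ`. -/
def shiftExt {D : ℕ} {M : Type*} [AddCommMonoid M] (f : Fin D → M) (n : ℕ) : M :=
  ∑ k : Fin D, if (k : ℕ) + 1 = n then f k else 0

section shiftExt

variable {D : ℕ} {M : Type*} [AddCommMonoid M]

lemma shiftExt_zero (f : Fin D → M) : shiftExt f 0 = 0 := by
  simp [shiftExt]

lemma shiftExt_succ (f : Fin D → M) (i : Fin D) : shiftExt f ((i : ℕ) + 1) = f i := by
  simp [shiftExt, Fin.val_inj]

lemma shiftExt_of_lt (f : Fin D → M) {n : ℕ} (hn : D < n) : shiftExt f n = 0 := by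
  refine Finset.sum_eq_zero fun k _ => if_neg ?_
  have := k.isLt
  omega

lemma shiftExt_cases (n : ℕ) (hn : n ≤ D) : n = 0 ∨ ∃ i : Fin D, n = (i : ℕ) + 1 := by
  rcases n with _ | n
  · exact Or.inl rfl
  · exact Or.inr ⟨⟨n, hn⟩, rfl⟩

end shiftExt

/-- Norms are monotone along diagonals for the rescaled zero-mode recursion. -/
lemma norm_le_norm_of_recursion {D : ℕ} {Θ : ℕ → ℝ} {q : ℕ → ℕ → ℂ} (h0 : Θ 0 = 0)
    (hpos : ∀ n, n < D → 0 < Θ (n + 1))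
    (hrec : ∀ i j, i < D → j < D →
      (((Θ i ^ 2 + Θ (i + 2) ^ 2 + Θ j ^ 2 + Θ (j + 2) ^ 2) / 2 : ℝ) : ℂ) * q (i + 1) (j + 1) =
        ((Θ (i + 2) * Θ (j + 2) : ℝ) : ℂ) * q (i + 2) (j + 2) +
          ((Θ i * Θ j : ℝ) : ℂ) * q i j)
    (i j : ℕ) (hi : i < D) (hj : j < D) :
    Θ i * Θ j * ‖q i j‖ ≤ Θ i * Θ j * ‖q (i + 1) (j + 1)‖ := by
  induction i generalizing j with
  | zero => simp [h0]
  | succ i ih =>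
    rcases j with _ | j
    · simp [h0]
    have hi' : i < D := by omega
    have hj' : j < D := by omega
    have hΘ : ∀ n, n < D → 0 ≤ Θ n := by
      rintro (_ | n) hn
      · exact h0.ge
      · exact (hpos n (by omega)).le
    have e := congrArg norm (hrec i j hi' hj')
    have tri := norm_add_le (((Θ (i + 2) * Θ (j + 2) : ℝ) : ℂ) * q (i + 2) (j + 2))
      (((Θ i * Θ j : ℝ) : ℂ) * q i j)
    rw [← e] at tri
    have hc : 0 < Θ (i + 2) * Θ (j + 2) := mul_pos (hpos _ hi) (hpos _ hj)
    have hc' : 0 ≤ Θ i * Θ j := mul_nonneg (hΘ i hi') (hΘ j hj')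
    simp only [norm_mul, Complex.norm_real, Real.norm_eq_abs] at tri
    rw [abs_of_nonneg (by positivity), ← abs_mul, ← abs_mul, abs_of_pos hc,
      abs_of_nonneg hc'] at tri
    refine mul_le_mul_of_nonneg_left ?_ (mul_pos (hpos i hi') (hpos j hj')).le
    refine le_of_mul_le_mul_left ?_ hc
    have := ih j hi' hj'
    nlinarith [mul_nonneg (sq_nonneg (Θ i - Θ j)) (norm_nonneg (q (i + 1) (j + 1))),
      mul_nonneg (sq_nonneg (Θ (i + 2) - Θ (j + 2))) (norm_nonneg (q (i + 1) (j + 1)))]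

lemma offDiag_eq_zero_of_recursion {D : ℕ} {Θ : ℕ → ℝ} {q : ℕ → ℕ → ℂ} (h0 : Θ 0 = 0)
    (hpos : ∀ n, n < D → 0 < Θ (n + 1)) (hlast : ∀ n, D < n → Θ n = 0)
    (hrec : ∀ i j, i < D → j < D →
      (((Θ i ^ 2 + Θ (i + 2) ^ 2 + Θ j ^ 2 + Θ (j + 2) ^ 2) / 2 : ℝ) : ℂ) * q (i + 1) (j + 1) =
        ((Θ (i + 2) * Θ (j + 2) : ℝ) : ℂ) * q (i + 2) (j + 2) +
          ((Θ i * Θ j : ℝ) : ℂ) * q i j)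
    (i j : ℕ) (hi : i < D) (hj : j < D) (hij : i ≠ j) : q (i + 1) (j + 1) = 0 := by
  have mono := norm_le_norm_of_recursion h0 hpos hrec
  obtain ⟨n, hn⟩ : ∃ n, max i j + 1 + n = D := ⟨D - (max i j + 1), by omega⟩
  induction n generalizing i j with
  | zero =>
    have hΘ : ∀ n, n < D → 0 ≤ Θ n := by
      rintro (_ | n) hn
      · exact h0.ge
      · exact (hpos n (by omega)).le
    have hc' : 0 ≤ Θ i * Θ j := mul_nonneg (hΘ i hi) (hΘ j hj)
    have hc : Θ (i + 2) * Θ (j + 2) = 0 := by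
      rcases lt_or_gt_of_ne hij with h | h
      · rw [hlast (j + 2) (by omega), mul_zero]
      · rw [hlast (i + 2) (by omega), zero_mul]
    have hs : 0 < Θ (i + 2) ^ 2 + Θ (j + 2) ^ 2 := by
      rcases lt_or_gt_of_ne hij with h | h
      · have := hpos (i + 1) (by omega)
        positivity
      · have := hpos (j + 1) (by omega)
        positivity
    have e := congrArg norm (hrec i j hi hj)
    rw [hc, Complex.ofReal_zero, zero_mul, zero_add, norm_mul, norm_mul, Complex.norm_real,
      Complex.norm_real, Real.norm_of_nonneg (by positivity), Real.norm_of_nonneg hc'] at e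
    have h1 := mono i j hi hj
    by_contra hne
    have hq := norm_pos_iff.mpr hne
    nlinarith [mul_nonneg (sq_nonneg (Θ i - Θ j)) hq.le, mul_pos hs hq]
  | succ n ih =>
    have hz := ih (i + 1) (j + 1) (by omega) (by omega) (by omega) (by omega)
    have h1 := mono (i + 1) (j + 1) (by omega) (by omega)
    rw [hz, norm_zero, mul_zero] at h1
    have := mul_pos (hpos i hi) (hpos j hj)
    exact norm_le_zero_iff.mp (by nlinarith)

lemma diag_eq_of_recursion {D : ℕ} {Θ : ℕ → ℝ} {q : ℕ → ℕ → ℂ} (h0 : Θ 0 = 0)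
    (hpos : ∀ n, n < D → 0 < Θ (n + 1))
    (hrec : ∀ i j, i < D → j < D →
      (((Θ i ^ 2 + Θ (i + 2) ^ 2 + Θ j ^ 2 + Θ (j + 2) ^ 2) / 2 : ℝ) : ℂ) * q (i + 1) (j + 1) =
        ((Θ (i + 2) * Θ (j + 2) : ℝ) : ℂ) * q (i + 2) (j + 2) +
          ((Θ i * Θ j : ℝ) : ℂ) * q i j)
    (i : ℕ) (hi : i < D) : q (i + 1) (i + 1) = q 1 1 := by
  have flux : ∀ i, i < D → (Θ i : ℂ) ^ 2 * (q (i + 1) (i + 1) - q i i) = 0 := by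
    intro i hi
    induction i with
    | zero => simp [h0]
    | succ i ih =>
      have h1 := ih (by omega)
      have h2 := hrec i i (by omega) (by omega)
      have h3 : (Θ (i + 2) : ℂ) ≠ 0 := Complex.ofReal_ne_zero.mpr (hpos _ hi).ne'
      push_cast at h2
      have h4 : (Θ (i + 2) : ℂ) ^ 2 * (q (i + 2) (i + 2) - q (i + 1) (i + 1)) = 0 := by
        linear_combination h1 - h2
      simp [(mul_eq_zero.mp h4).resolve_left (pow_ne_zero 2 h3)]
  induction i with
  | zero => rfl
  | succ i ih =>
    have h3 : (Θ (i + 1) : ℂ) ≠ 0 := Complex.ofReal_ne_zero.mpr (hpos i (by omega)).ne'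
    have := (mul_eq_zero.mp (flux (i + 1) hi)).resolve_left (pow_ne_zero 2 h3)
    rw [sub_eq_zero.mp this, ih (by omega)]

open Matrix in
/-- The matrix of the lowering jump operator in the eigenbasis. -/
def lowerJump {D : ℕ} (θ : Fin D → ℝ) : Matrix (Fin D) (Fin D) ℂ :=
  of fun i j => if (i : ℕ) + 1 = j then (θ i : ℂ) else 0

open Matrix in
/-- The matrix of the raising jump operator in the eigenbasis. -/
def raiseJump {D : ℕ} (θ : Fin D → ℝ) : Matrix (Fin D) (Fin D) ℂ :=
  of fun i j => if (j : ℕ) + 1 = i then (θ i : ℂ) else 0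

open Matrix in
/-- Zero-Hamiltonian Lindblad generator with two jump operators. -/
noncomputable def lindblad {n : Type*} [Fintype n] (A B X : Matrix n n ℂ) : Matrix n n ℂ :=
  (-((1 : ℂ) / 2) • (Aᴴ * A + Bᴴ * B)) * X + X * (-((1 : ℂ) / 2) • (Aᴴ * A + Bᴴ * B))ᴴ +
    A * X * Aᴴ + B * X * Bᴴ

open Matrix in
lemma lindblad_conj {n : Type*} [Fintype n] [DecidableEq n] {U : Matrix n n ℂ}
    (hU : Uᴴ * U = 1) (A B X : Matrix n n ℂ) :
    lindblad (U * A * Uᴴ) (U * B * Uᴴ) (U * X * Uᴴ) = U * lindblad A B X * Uᴴ := by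
  have key : ∀ M N : Matrix n n ℂ, U * M * Uᴴ * (U * N * Uᴴ) = U * (M * N) * Uᴴ := by
    intro M N
    calc U * M * Uᴴ * (U * N * Uᴴ) = U * M * (Uᴴ * U) * N * Uᴴ := by simp only [Matrix.mul_assoc]
      _ = _ := by rw [hU]; simp only [Matrix.mul_assoc, Matrix.one_mul]
  have keyH : ∀ M : Matrix n n ℂ, (U * M * Uᴴ)ᴴ = U * Mᴴ * Uᴴ := by
    intro M
    simp [Matrix.mul_assoc]
  simp only [lindblad, conjTranspose_smul, conjTranspose_add, keyH, key, smul_mul_assoc,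
    mul_smul_comm, Matrix.mul_add, Matrix.add_mul, conjTranspose_mul, conjTranspose_conjTranspose]

open Matrix in
lemma lowerJump_conjTranspose_mul_self {D : ℕ} (θ : Fin D → ℝ) :
    (lowerJump θ)ᴴ * lowerJump θ = diagonal fun i : Fin D => ((shiftExt θ i ^ 2 : ℝ) : ℂ) := by
  ext i j
  rw [mul_apply, diagonal_apply]
  split_ifs with h
  · subst h
    obtain h | ⟨k, hk⟩ := shiftExt_cases (i : ℕ) i.isLt.le
    · simp [lowerJump, h, shiftExt_zero]
    · rw [hk, shiftExt_succ]
      simp [lowerJump, hk, Fin.val_inj, sq, apply_ite]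
  · refine Finset.sum_eq_zero fun k _ => ?_
    have : (i : ℕ) ≠ j := Fin.val_ne_of_ne h
    simp only [lowerJump, conjTranspose_apply, of_apply]
    split_ifs <;> first | omega | simp

open Matrix in
lemma raiseJump_conjTranspose_mul_self {D : ℕ} (θ : Fin D → ℝ) :
    (raiseJump θ)ᴴ * raiseJump θ =
      diagonal fun i : Fin D => ((shiftExt θ ((i : ℕ) + 2) ^ 2 : ℝ) : ℂ) := by
  ext i j
  rw [mul_apply, diagonal_apply]
  split_ifs with h
  · subst h
    by_cases hi : (i : ℕ) + 1 < D
    · have := shiftExt_succ θ ⟨(i : ℕ) + 1, hi⟩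
      rw [this, Finset.sum_eq_single ⟨(i : ℕ) + 1, hi⟩]
      · simp [raiseJump, sq]
      · intro k _ hk
        have : (i : ℕ) + 1 ≠ k := fun h => hk (Fin.ext h.symm)
        simp [raiseJump, this]
      · simp
    · rw [shiftExt_of_lt θ (by omega)]
      refine (Finset.sum_eq_zero fun k _ => ?_).trans (by simp)
      have : (i : ℕ) + 1 ≠ k := by omega
      simp [raiseJump, this]
  · refine Finset.sum_eq_zero fun k _ => ?_
    have : (i : ℕ) ≠ j := Fin.val_ne_of_ne h
    simp only [raiseJump, conjTranspose_apply, of_apply]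
    split_ifs <;> first | omega | simp

open Matrix in
lemma lowerJump_mul_mul_apply {D : ℕ} (θ : Fin D → ℝ) (X : Fin D → Fin D → ℂ)
    (i j : Fin D) : (lowerJump θ * of X * (lowerJump θ)ᴴ) i j =
      θ i * θ j * shiftExt (fun k => shiftExt (X k) ((j : ℕ) + 2)) ((i : ℕ) + 2) := by
  have e : ∀ a b : Fin D, ((a : ℕ) + 1 = b) = ((b : ℕ) + 1 = a + 2) := by
    intro a b
    apply propext
    omega
  rw [Matrix.mul_assoc]
  simp only [mul_apply, conjTranspose_apply, lowerJump, of_apply, shiftExt, Finset.mul_sum, e]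
  refine Finset.sum_congr rfl fun k _ => ?_
  split_ifs
  · rw [Finset.mul_sum]
    refine Finset.sum_congr rfl fun l _ => ?_
    split_ifs <;> simp
    ring
  · simp

open Matrix in
lemma raiseJump_mul_mul_apply {D : ℕ} (θ : Fin D → ℝ) (X : Fin D → Fin D → ℂ)
    (i j : Fin D) : (raiseJump θ * of X * (raiseJump θ)ᴴ) i j =
      θ i * θ j * shiftExt (fun k => shiftExt (X k) (j : ℕ)) (i : ℕ) := by
  rw [Matrix.mul_assoc]
  simp only [mul_apply, conjTranspose_apply, raiseJump, of_apply, shiftExt, Finset.mul_sum]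
  refine Finset.sum_congr rfl fun k _ => ?_
  split_ifs
  · rw [Finset.mul_sum]
    refine Finset.sum_congr rfl fun l _ => ?_
    split_ifs <;> simp
    ring
  · simp

lemma shiftExt_rescale {D : ℕ} (θ : Fin D → ℝ) (Y : Fin D → Fin D → ℂ) (m n : ℕ) :
    shiftExt (fun k => shiftExt (fun l => θ k * θ l * Y k l) n) m =
      ((shiftExt θ m * shiftExt θ n : ℝ) : ℂ) * shiftExt (fun k => shiftExt (Y k) n) m := by
  by_cases hm : m ≤ D
  · by_cases hn : n ≤ D
    · obtain rfl | ⟨i, rfl⟩ := shiftExt_cases m hm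
      · simp [shiftExt_zero]
      obtain rfl | ⟨j, rfl⟩ := shiftExt_cases n hn
      · simp [shiftExt_succ, shiftExt_zero]
      simp [shiftExt_succ]
    · have hn := not_le.mp hn
      rw [shiftExt_of_lt θ hn]
      simp only [shiftExt_of_lt _ hn]
      simp [shiftExt]
  · have hm := not_le.mp hm
    simp [shiftExt_of_lt _ hm]

lemma shiftExt_mul_diag {D : ℕ} (θ : Fin D → ℝ) (c : ℂ) (m n : ℕ) :
    ((shiftExt θ m * shiftExt θ n : ℝ) : ℂ) *
        shiftExt (fun k : Fin D => shiftExt (fun l : Fin D => if k = l then c else 0) n) m =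
      if m = n then ((shiftExt θ m : ℝ) : ℂ) ^ 2 * c else 0 := by
  split_ifs with h
  · subst h
    by_cases hm : m ≤ D
    · obtain rfl | ⟨i, rfl⟩ := shiftExt_cases m hm
      · simp [shiftExt_zero]
      · simp only [shiftExt_succ, if_true]
        push_cast
        ring
    · simp [shiftExt_of_lt θ (not_le.mp hm)]
  · refine mul_eq_zero_of_right _ (Finset.sum_eq_zero fun k _ => ?_)
    split_ifs with hk
    · refine Finset.sum_eq_zero fun l _ => ?_
      split_ifs with hl
      · have hkl : k ≠ l := by
          rintro rfl
          exact h (hk.symm.trans hl)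
        exact if_neg hkl
      · rfl
    · rfl

open Matrix in
lemma lindblad_jump_apply {D : ℕ} (θ : Fin D → ℝ) (Y : Fin D → Fin D → ℂ)
    (i j : Fin D) :
    lindblad (lowerJump θ) (raiseJump θ) (of fun k l => θ k * θ l * Y k l) i j =
      θ i * θ j *
        (((shiftExt θ ((i : ℕ) + 2) * shiftExt θ ((j : ℕ) + 2) : ℝ) : ℂ) *
            shiftExt (fun k => shiftExt (Y k) ((j : ℕ) + 2)) ((i : ℕ) + 2) +
          ((shiftExt θ i * shiftExt θ j : ℝ) : ℂ) *
            shiftExt (fun k => shiftExt (Y k) (j : ℕ)) (i : ℕ) -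
          (((shiftExt θ i ^ 2 + shiftExt θ ((i : ℕ) + 2) ^ 2 + shiftExt θ j ^ 2 +
            shiftExt θ ((j : ℕ) + 2) ^ 2) / 2 : ℝ) : ℂ) *
            shiftExt (fun k => shiftExt (Y k) ((j : ℕ) + 1)) ((i : ℕ) + 1)) := by
  rw [lindblad, lowerJump_conjTranspose_mul_self, raiseJump_conjTranspose_mul_self,
    diagonal_add, ← diagonal_smul, diagonal_conjTranspose]
  rw [Matrix.add_apply, Matrix.add_apply, Matrix.add_apply, lowerJump_mul_mul_apply,
    raiseJump_mul_mul_apply, diagonal_mul, mul_diagonal]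
  simp only [of_apply, shiftExt_rescale, shiftExt_succ]
  simp
  ring

open Matrix in
lemma lindblad_jump_eq_zero_iff {D : ℕ} (θ : Fin D → ℝ) (hθ : ∀ i, 0 < θ i)
    (X : Matrix (Fin D) (Fin D) ℂ) :
    lindblad (lowerJump θ) (raiseJump θ) X = 0 ↔
      ∃ c : ℂ, X = c • diagonal fun i => (θ i : ℂ) ^ 2 := by
  have hne : ∀ i, (θ i : ℂ) ≠ 0 := fun i => Complex.ofReal_ne_zero.mpr (hθ i).ne'
  obtain ⟨Y, rfl⟩ : ∃ Y : Fin D → Fin D → ℂ, X = of fun k l => θ k * θ l * Y k l := by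
    refine ⟨fun k l => X k l / (θ k * θ l), ?_⟩
    ext k l
    have := hne k
    have := hne l
    simp only [of_apply]
    field_simp
  constructor
  · intro h
    have hpos : ∀ n, n < D → 0 < shiftExt θ (n + 1) := fun n hn =>
      (hθ ⟨n, hn⟩).trans_eq (shiftExt_succ θ ⟨n, hn⟩).symm
    let q : ℕ → ℕ → ℂ := fun m n => shiftExt (fun k => shiftExt (Y k) n) m
    have hq : ∀ i j : Fin D, q (i + 1) (j + 1) = Y i j := fun i j => by
      simp [q, shiftExt_succ]
    have hrec : ∀ i j, i < D → j < D →
        (((shiftExt θ i ^ 2 + shiftExt θ (i + 2) ^ 2 + shiftExt θ j ^ 2 +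
          shiftExt θ (j + 2) ^ 2) / 2 : ℝ) : ℂ) * q (i + 1) (j + 1) =
        ((shiftExt θ (i + 2) * shiftExt θ (j + 2) : ℝ) : ℂ) * q (i + 2) (j + 2) +
          ((shiftExt θ i * shiftExt θ j : ℝ) : ℂ) * q i j := by
      intro i j hi hj
      have := congrFun (congrFun h ⟨i, hi⟩) ⟨j, hj⟩
      rw [lindblad_jump_apply, Matrix.zero_apply] at this
      exact (sub_eq_zero.mp ((mul_eq_zero.mp this).resolve_left
        (mul_ne_zero (hne _) (hne _)))).symm
    refine ⟨q 1 1, ?_⟩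
    ext i j
    rw [of_apply, Matrix.smul_apply, diagonal_apply, ← hq]
    split_ifs with hij
    · subst hij
      rw [diag_eq_of_recursion (q := q) (shiftExt_zero θ) hpos hrec i i.isLt, smul_eq_mul]
      ring
    · rw [offDiag_eq_zero_of_recursion (q := q) (shiftExt_zero θ) hpos
        (fun n hn => shiftExt_of_lt θ hn) hrec i j i.isLt j.isLt (Fin.val_ne_of_ne hij)]
      simp
  · rintro ⟨c, hc⟩
    have hY : Y = fun i j => if i = j then c else 0 := by
      ext i j
      have h := congrFun (congrFun hc i) j
      rw [of_apply, Matrix.smul_apply, diagonal_apply] at h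
      refine mul_left_cancel₀ (mul_ne_zero (hne i) (hne j)) (h.trans ?_)
      split_ifs with hij
      · subst hij
        simp only [smul_eq_mul]
        ring
      · simp
    ext i j
    rw [lindblad_jump_apply, Matrix.zero_apply, hY, shiftExt_mul_diag, shiftExt_mul_diag]
    simp only [shiftExt_succ, Nat.add_right_cancel_iff, Fin.val_inj]
    split_ifs with hij
    · subst hij
      push_cast
      ring
    · simp

open Matrix in
lemma conj_eq_sum_vecMulVec {n : Type*} [Fintype n] (U M : Matrix n n ℂ) (v : n → n → ℂ)
    (hv : ∀ i a, v i a = U a i) :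
    U * M * Uᴴ = ∑ i, ∑ j, M i j • vecMulVec (v i) (star (v j)) := by
  ext a b
  simp only [mul_apply, Matrix.sum_apply, Matrix.smul_apply, vecMulVec_apply, conjTranspose_apply,
    hv, Pi.star_apply, smul_eq_mul, Finset.sum_mul]
  rw [Finset.sum_comm]
  refine Finset.sum_congr rfl fun i _ => Finset.sum_congr rfl fun j _ => ?_
  ring


open Matrix in
/-- Key step in case (i) of Proposition 2: the Lindbladian
`ℒ(ρ) = Qρ + ρQᴴ + R₁ρR₁ᴴ + R₂ρR₂ᴴ` with zero Hamiltonian and jump operators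
`R₁ = Σ θᵢ vᵢvᵢ₊₁ᴴ`, `R₂ = Σ θᵢ₊₁ vᵢ₊₁vᵢᴴ` annihilates `ρ` iff `ρ` is a scalar
multiple of `σ = Σ θᵢ² vᵢvᵢᴴ`. -/
theorem kernel_of_depolarising_lindbladian
    (D : ℕ) (hD : 1 ≤ D) (U : Matrix.unitaryGroup (Fin D) ℂ)
    (v : Fin D → Fin D → ℂ)
    (hv : ∀ i a, v i a = (U : Matrix (Fin D) (Fin D) ℂ) a i)
    (θ : Fin D → ℝ) (hθpos : ∀ i, 0 < θ i) (hθsum : ∑ i, (θ i) ^ 2 = 1)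
    (σ R₁ R₂ Q : Matrix (Fin D) (Fin D) ℂ)
    (hσ : σ = ∑ i, ((θ i : ℂ) ^ 2) • Matrix.vecMulVec (v i) (star (v i)))
    (hR₁ : R₁ = ∑ i : Fin D, if h : (i : ℕ) + 1 < D then
      (θ i : ℂ) • Matrix.vecMulVec (v i) (star (v ⟨(i : ℕ) + 1, h⟩)) else 0)
    (hR₂ : R₂ = ∑ i : Fin D, if h : (i : ℕ) + 1 < D then
      (θ ⟨(i : ℕ) + 1, h⟩ : ℂ) • Matrix.vecMulVec (v ⟨(i : ℕ) + 1, h⟩) (star (v i)) else 0)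
    (hQ : Q = -((1 : ℂ) / 2) • (R₁ᴴ * R₁ + R₂ᴴ * R₂)) :
    ∀ ρ : Matrix (Fin D) (Fin D) ℂ,
      Q * ρ + ρ * Qᴴ + R₁ * ρ * R₁ᴴ + R₂ * ρ * R₂ᴴ = 0 ↔ ∃ c : ℂ, ρ = c • σ := by
  have hU : (U : Matrix (Fin D) (Fin D) ℂ)ᴴ * U = 1 := Matrix.UnitaryGroup.star_mul_self U
  have hU' : (U : Matrix (Fin D) (Fin D) ℂ) * (U : Matrix (Fin D) (Fin D) ℂ)ᴴ = 1 :=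
    mul_eq_one_comm.mp hU
  generalize (U : Matrix (Fin D) (Fin D) ℂ) = W at hU hU' hv
  have conj_cancel : ∀ M : Matrix (Fin D) (Fin D) ℂ, Wᴴ * (W * M * Wᴴ) * W = M := fun M => by
    calc Wᴴ * (W * M * Wᴴ) * W = (Wᴴ * W) * M * (Wᴴ * W) := by simp only [Matrix.mul_assoc]
      _ = M := by rw [hU, Matrix.one_mul, Matrix.mul_one]
  have conj_inj : ∀ M N : Matrix (Fin D) (Fin D) ℂ, W * M * Wᴴ = W * N * Wᴴ ↔ M = N :=
    fun M N => ⟨fun h => by rw [← conj_cancel M, h, conj_cancel], fun h => by rw [h]⟩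
  have hσ' : σ = W * diagonal (fun i => (θ i : ℂ) ^ 2) * Wᴴ := by
    rw [hσ, conj_eq_sum_vecMulVec W _ v hv]
    simp [diagonal_apply, ite_smul]
  have hR₁' : R₁ = W * lowerJump θ * Wᴴ := by
    rw [hR₁, conj_eq_sum_vecMulVec W _ v hv]
    refine Finset.sum_congr rfl fun i _ => ?_
    split_ifs with h
    · rw [Finset.sum_eq_single ⟨(i : ℕ) + 1, h⟩]
      · simp [lowerJump]
      · intro k _ hk
        have : (i : ℕ) + 1 ≠ k := fun h => hk (Fin.ext h.symm)
        simp [lowerJump, this]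
      · simp
    · refine (Finset.sum_eq_zero fun k _ => ?_).symm
      have : (i : ℕ) + 1 ≠ k := by omega
      simp [lowerJump, this]
  have hR₂' : R₂ = W * raiseJump θ * Wᴴ := by
    rw [hR₂, conj_eq_sum_vecMulVec W _ v hv, Finset.sum_comm]
    refine Finset.sum_congr rfl fun i _ => ?_
    split_ifs with h
    · rw [Finset.sum_eq_single ⟨(i : ℕ) + 1, h⟩]
      · simp [raiseJump]
      · intro k _ hk
        have : (i : ℕ) + 1 ≠ k := fun h => hk (Fin.ext h.symm)
        simp [raiseJump, this]
      · simp
    · refine (Finset.sum_eq_zero fun k _ => ?_).symm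
      have : (i : ℕ) + 1 ≠ k := by omega
      simp [raiseJump, this]
  intro ρ
  obtain ⟨X, rfl⟩ : ∃ X, ρ = W * X * Wᴴ := by
    refine ⟨Wᴴ * ρ * W, ?_⟩
    calc ρ = (W * Wᴴ) * ρ * (W * Wᴴ) := by rw [hU', Matrix.one_mul, Matrix.mul_one]
      _ = _ := by simp only [Matrix.mul_assoc]
  have hL := lindblad_conj hU (lowerJump θ) (raiseJump θ) X
  rw [← hR₁', ← hR₂', lindblad, ← hQ] at hL
  have h0 : (0 : Matrix (Fin D) (Fin D) ℂ) = W * 0 * Wᴴ := by simp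
  rw [hL, h0, conj_inj, lindblad_jump_eq_zero_iff θ hθpos, hσ']
  refine exists_congr fun c => ?_
  rw [← conj_inj, Matrix.mul_smul, Matrix.smul_mul]
end

section
/- With the setup and standing assumptions of the Appendix-B characterisation (in particular 𝒫(ℒ(X)) = 𝒫(ℒ(𝒫(X))) for all X), assume in addition S ≠ 0, T ≠ 0 and V ≠ 0. Then either T is a scalar multiple of the identity (∃ τ ∈ ℂ, T = τ • I), or V is proportional to a unitary (∃ c : ℝ, 0 < c ∧ Vᴴ*V = (c : ℂ) • I). -/
open scoped Kronecker

open Matrix in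
/-- A matrix orthogonal to all traceless matrices is scalar. -/
theorem Matrix.eq_smul_one_of_trace_mul_eq_zero {ι 𝕜 : Type*} [Fintype ι] [DecidableEq ι]
    [CommRing 𝕜] (M : Matrix ι ι 𝕜) (h : ∀ Z : Matrix ι ι 𝕜, Z.trace = 0 → (M * Z).trace = 0)
    (i : ι) : M = M i i • 1 := by
  ext a b
  by_cases hab : a = b
  · subst hab
    have := h (single a a 1 - single i i 1) (by simp [trace_sub])
    simp only [mul_sub, trace_sub, trace_mul_single, sub_eq_zero] at this
    simpa using this
  · have := h (single b a 1) (trace_single_eq_of_ne b a 1 (Ne.symm hab))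
    simpa [hab, trace_mul_single] using this

open Matrix in
/-- If the sandwich map `F ↦ T * F * Tᴴ` is a nonzero multiple of a map of the form
`F ↦ K * F + F * K'`, then `T` is scalar. The hypothesis is stated on matrix units. -/
theorem Matrix.eq_smul_one_of_sandwich_eq {ι 𝕜 : Type*} [DecidableEq ι] [RCLike 𝕜]
    (T K K' : Matrix ι ι 𝕜) {s : 𝕜} (hs : s ≠ 0)
    (h : ∀ a b x y, s * (T x a * star (T y b)) =
      (if y = b then K x a else 0) + (if x = a then K' b y else 0)) (i : ι) :
    T = T i i • 1 := by
  ext a b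
  by_cases hab : a = b
  · subst hab
    have key : s * ((T a a - T i i) * star (T a a - T i i)) = 0 := by
      have h1 := h a a a a
      have h2 := h a i a i
      have h3 := h i a i a
      have h4 := h i i i i
      simp only [if_true] at h1 h2 h3 h4
      rw [star_sub]
      linear_combination h1 - h2 - h3 + h4
    have hsq := (mul_eq_zero.mp key).resolve_left hs
    have := (mul_eq_zero.mp hsq).elim id (fun h => star_eq_zero.mp h)
    simpa [sub_eq_zero] using this
  · simpa [hab, hs] using h b b a a

open Matrix in
/-- Partial trace of a diagonal block of a triple Kronecker product. -/
theorem Matrix.sum_kronecker_kronecker_apply {ι κ μ 𝕜 : Type*} [Fintype μ] [CommSemiring 𝕜]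
    (G : Matrix ι ι 𝕜) (F : Matrix κ κ 𝕜) (Z : Matrix μ μ 𝕜) (j : ι) (x y : κ) :
    ∑ γ, (G ⊗ₖ (F ⊗ₖ Z)) (j, x, γ) (j, y, γ) = G j j * F x y * Z.trace := by
  simp [kroneckerMap_apply, trace, Finset.mul_sum, mul_assoc]


open Matrix ComplexOrder in
/-- Proposition 3 excludes the case where simultaneously `T` is not proportional to the
identity and `V` is not proportional to a unitary. -/
theorem appendixB_T_or_V_constrained
    (n D₁ m₁ : ℕ) (hn : 1 ≤ n) (hD₁ : 1 ≤ D₁) (hm₁ : 1 ≤ m₁)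
    (A : Matrix (Fin n) (Fin n) ℂ) (B : Matrix (Fin D₁) (Fin D₁) ℂ)
    (C : Matrix (Fin m₁) (Fin m₁) ℂ)
    (hA : A.IsHermitian) (hB : B.IsHermitian) (hC : C.IsHermitian)
    (S : Matrix (Fin n) (Fin n) ℂ) (T : Matrix (Fin D₁) (Fin D₁) ℂ)
    (V : Matrix (Fin m₁) (Fin m₁) ℂ)
    (H R : Matrix (Fin n × Fin D₁ × Fin m₁) (Fin n × Fin D₁ × Fin m₁) ℂ)
    (hH : ∀ p q : Fin n × Fin D₁ × Fin m₁,
      H p q = A p.1 q.1 * B p.2.1 q.2.1 * C p.2.2 q.2.2)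
    (hR : ∀ p q : Fin n × Fin D₁ × Fin m₁,
      R p q = S p.1 q.1 * T p.2.1 q.2.1 * V p.2.2 q.2.2)
    (Q : Matrix (Fin n × Fin D₁ × Fin m₁) (Fin n × Fin D₁ × Fin m₁) ℂ)
    (hQ : Q = -Complex.I • H - ((1 : ℂ) / 2) • (Rᴴ * R))
    (Lmap : Matrix (Fin n × Fin D₁ × Fin m₁) (Fin n × Fin D₁ × Fin m₁) ℂ →
      Matrix (Fin n × Fin D₁ × Fin m₁) (Fin n × Fin D₁ × Fin m₁) ℂ)
    (hLmap : ∀ X, Lmap X = Q * X + X * Qᴴ + R * X * Rᴴ)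
    (σ : Fin n → Matrix (Fin m₁) (Fin m₁) ℂ)
    (hσpos : ∀ k, (σ k).PosDef) (hσtr : ∀ k, (σ k).trace = 1)
    (Pmap : Matrix (Fin n × Fin D₁ × Fin m₁) (Fin n × Fin D₁ × Fin m₁) ℂ →
      Matrix (Fin n × Fin D₁ × Fin m₁) (Fin n × Fin D₁ × Fin m₁) ℂ)
    (hPmap : ∀ (X : Matrix (Fin n × Fin D₁ × Fin m₁) (Fin n × Fin D₁ × Fin m₁) ℂ)
      (p q : Fin n × Fin D₁ × Fin m₁),
      Pmap X p q = if p.1 = q.1 then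
        σ p.1 p.2.2 q.2.2 * (∑ γ, X (p.1, p.2.1, γ) (p.1, q.2.1, γ)) else 0)
    (hPLP : ∀ X, Pmap (Lmap X) = Pmap (Lmap (Pmap X)))
    (hS0 : S ≠ 0) (hT0 : T ≠ 0) (hV0 : V ≠ 0) :
    (∃ τ : ℂ, T = τ • 1) ∨
      (∃ c : ℝ, 0 < c ∧ Vᴴ * V = (c : ℂ) • 1) := by
  by_cases hM : ∀ Z : Matrix (Fin m₁) (Fin m₁) ℂ, Z.trace = 0 → (Vᴴ * V * Z).trace = 0
  · right
    let i : Fin m₁ := ⟨0, hm₁⟩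
    have hscal := Matrix.eq_smul_one_of_trace_mul_eq_zero _ hM i
    have hnn : 0 ≤ (Vᴴ * V) i i := (posSemidef_conjTranspose_mul_self V).diag_nonneg
    have hne : (Vᴴ * V) i i ≠ 0 := fun h0 => by
      rw [h0, zero_smul] at hscal
      exact hV0 (conjTranspose_mul_self_eq_zero.mp hscal)
    obtain ⟨c, hc⟩ : ∃ c : ℝ, (c : ℂ) = (Vᴴ * V) i i :=
      ⟨((Vᴴ * V) i i).re, Complex.ext rfl (Complex.nonneg_iff.mp hnn).2⟩
    rw [← hc] at hscal hnn hne
    refine ⟨c, lt_of_le_of_ne (by exact_mod_cast hnn) ?_, hscal⟩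
    rintro rfl
    simp at hne
  left
  push Not at hM
  obtain ⟨Z, hZ, hw⟩ := hM
  have hH' : H = A ⊗ₖ (B ⊗ₖ C) := by ext p q; simp [hH, kroneckerMap_apply, mul_assoc]
  have hR' : R = S ⊗ₖ (T ⊗ₖ V) := by ext p q; simp [hR, kroneckerMap_apply, mul_assoc]
  have hHH : Hᴴ = H := by
    rw [hH', conjTranspose_kronecker, conjTranspose_kronecker, hA.eq, hB.eq, hC.eq]
  have hRR : Rᴴ * R = (Sᴴ * S) ⊗ₖ ((Tᴴ * T) ⊗ₖ (Vᴴ * V)) := by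
    simp only [hR', conjTranspose_kronecker, ← mul_kronecker_mul]
  have hL0 : Lmap 0 = 0 := by simp [hLmap]
  have hP0 : Pmap 0 = 0 := by ext p q; simp [hPmap]
  have hblock : ∀ X, Pmap X = 0 → ∀ j x y, ∑ γ, Lmap X (j, x, γ) (j, y, γ) = 0 := by
    intro X hX j x y
    obtain ⟨α, hα⟩ : ∃ α, σ j α α ≠ 0 := by
      by_contra! h0
      simpa [trace, h0] using hσtr j
    have h0 : Pmap (Lmap X) = 0 := by rw [hPLP, hX, hL0, hP0]
    have h1 := hPmap (Lmap X) (j, x, α) (j, y, α)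
    rw [h0] at h1
    simpa [hα] using h1.symm
  have hmain : ∀ (G : Matrix (Fin n) (Fin n) ℂ) (F : Matrix (Fin D₁) (Fin D₁) ℂ) j x y,
      -Complex.I * ((A * G) j j * (B * F) x y * (C * Z).trace)
      - 1 / 2 * ((Sᴴ * S * G) j j * (Tᴴ * T * F) x y * (Vᴴ * V * Z).trace)
      + (Complex.I * ((G * A) j j * (F * B) x y * (Z * C).trace)
      - 1 / 2 * ((G * (Sᴴ * S)) j j * (F * (Tᴴ * T)) x y * (Vᴴ * V * Z).trace))
      + (S * G * Sᴴ) j j * (T * F * Tᴴ) x y * (Vᴴ * V * Z).trace = 0 := by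
    intro G F j x y
    have hPX : Pmap (G ⊗ₖ (F ⊗ₖ Z)) = 0 := by
      ext p q
      rw [hPmap, sum_kronecker_kronecker_apply, hZ]
      simp
    have hLX : Lmap (G ⊗ₖ (F ⊗ₖ Z)) =
        -Complex.I • ((A * G) ⊗ₖ ((B * F) ⊗ₖ (C * Z)))
        - (1 / 2 : ℂ) • ((Sᴴ * S * G) ⊗ₖ ((Tᴴ * T * F) ⊗ₖ (Vᴴ * V * Z)))
        + (Complex.I • ((G * A) ⊗ₖ ((F * B) ⊗ₖ (Z * C)))
        - (1 / 2 : ℂ) • ((G * (Sᴴ * S)) ⊗ₖ ((F * (Tᴴ * T)) ⊗ₖ (Z * (Vᴴ * V)))))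
        + (S * G * Sᴴ) ⊗ₖ ((T * F * Tᴴ) ⊗ₖ (V * Z * Vᴴ)) := by
      have hQ' : Qᴴ = Complex.I • H - ((1 : ℂ) / 2) • (Rᴴ * R) := by
        simp [hQ, conjTranspose_sub, conjTranspose_smul, conjTranspose_mul, hHH]
      rw [hLmap, hQ', hQ, hRR, hH', hR']
      simp only [conjTranspose_kronecker, mul_kronecker_mul, sub_mul, mul_sub, smul_mul_assoc,
        mul_smul_comm]
    have h := hblock _ hPX j x y
    rw [hLX] at h
    simp only [Matrix.add_apply, Matrix.sub_apply, Matrix.smul_apply, smul_eq_mul, Finset.sum_add_distrib,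
      Finset.sum_sub_distrib, ← Finset.mul_sum, sum_kronecker_kronecker_apply] at h
    rwa [trace_mul_comm Z (Vᴴ * V), trace_mul_cycle V Z Vᴴ] at h
  have hunit : ∀ k j a b x y,
      S j k * star (S j k) * (Vᴴ * V * Z).trace * (T x a * star (T y b)) =
      (if j = k then
        (if y = b then (Complex.I * A k k * (C * Z).trace * B x a
          + 1 / 2 * (Sᴴ * S) k k * (Vᴴ * V * Z).trace * (Tᴴ * T) x a) else 0)
        + (if x = a then (-Complex.I * A k k * (Z * C).trace * B b y
          + 1 / 2 * (Sᴴ * S) k k * (Vᴴ * V * Z).trace * (Tᴴ * T) b y) else 0) else 0) := by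
    intro k j a b x y
    have hms : ∀ {N : ℕ} (M : Matrix (Fin N) (Fin N) ℂ) (p q r t : Fin N),
        (M * single p q (1 : ℂ)) r t = if t = q then M r p else 0 := by
      intro N M p q r t
      split_ifs with h
      · subst h; simp
      · simp [h]
    have hsm : ∀ {N : ℕ} (M : Matrix (Fin N) (Fin N) ℂ) (p q r t : Fin N),
        (single p q (1 : ℂ) * M) r t = if r = p then M q t else 0 := by
      intro N M p q r t
      split_ifs with h
      · subst h; simp
      · simp [h]
    have h := hmain (single k k 1) (single a b 1) j x y
    have hmsm : ∀ {N : ℕ} (M : Matrix (Fin N) (Fin N) ℂ) (p q r t : Fin N),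
        (M * single p q (1 : ℂ) * Mᴴ) r t = M r p * star (M t q) := by
      intro N M p q r t
      rw [mul_assoc, mul_apply]
      simp [hsm]
    simp only [hmsm] at h
    simp only [hms, hsm] at h
    split_ifs at h ⊢ <;> subst_vars <;> linear_combination h
  obtain ⟨x₀, a₀, hxa⟩ : ∃ x a, T x a ≠ 0 := by
    by_contra! h0
    exact hT0 (Matrix.ext h0)
  have hoff : ∀ j k, j ≠ k → S j k = 0 := by
    intro j k hjk
    have h := hunit k j a₀ a₀ x₀ x₀
    simpa [hjk, hw, hxa] using h
  obtain ⟨k, hk⟩ : ∃ k, S k k ≠ 0 := by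
    by_contra! h0
    refine hS0 (Matrix.ext fun j k => ?_)
    by_cases hjk : j = k
    · subst hjk; exact h0 j
    · exact hoff j k hjk
  refine ⟨_, eq_smul_one_of_sandwich_eq T
    ((Complex.I * A k k * (C * Z).trace) • B
      + (1 / 2 * (Sᴴ * S) k k * (Vᴴ * V * Z).trace) • (Tᴴ * T))
    ((-Complex.I * A k k * (Z * C).trace) • B
      + (1 / 2 * (Sᴴ * S) k k * (Vᴴ * V * Z).trace) • (Tᴴ * T))
    (s := S k k * star (S k k) * (Vᴴ * V * Z).trace) (by simp [hk, hw])
    (fun a b x y => ?_) ⟨0, hD₁⟩⟩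
  simpa only [if_true, Matrix.add_apply, Matrix.smul_apply, smul_eq_mul] using hunit k k a b x y
end

section
/- With the setup and standing assumptions of the Appendix-B characterisation (in particular 𝒫(ℒ(X)) = 𝒫(ℒ(𝒫(X))) for all X), assume in addition that S ≠ 0, V ≠ 0, and that T is not a scalar multiple of the identity (¬∃ τ ∈ ℂ, T = τ • I). Then V is proportional to a unitary (∃ c : ℝ, 0 < c ∧ Vᴴ*V = (c : ℂ) • I), and every row of S has at most one non-zero entry: for all k and all l ≠ m, S_{k,l} = 0 or S_{k,m} = 0. -/
section

open Matrix Kronecker ComplexOrder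

variable {ι κ μ : Type*} [Fintype μ]

/-- The diagonal block of `X` at `k`, traced over the last tensor factor. -/
def blockTrace (k : ι) (X : Matrix (ι × κ × μ) (ι × κ × μ) ℂ) : Matrix κ κ ℂ :=
  Matrix.of fun a b => ∑ γ, X (k, a, γ) (k, b, γ)

theorem blockTrace_add (k : ι) (X Y : Matrix (ι × κ × μ) (ι × κ × μ) ℂ) :
    blockTrace k (X + Y) = blockTrace k X + blockTrace k Y := by
  ext a b
  simp [blockTrace, Finset.sum_add_distrib]

theorem blockTrace_kronecker (k : ι) (E : Matrix ι ι ℂ) (M : Matrix κ κ ℂ) (N : Matrix μ μ ℂ) :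
    blockTrace k (E ⊗ₖ (M ⊗ₖ N)) = (E k k * N.trace) • M := by
  ext a b
  simp only [blockTrace, Matrix.of_apply, kroneckerMap_apply, Matrix.smul_apply, smul_eq_mul,
    Matrix.trace, Matrix.diag_apply, Finset.mul_sum, Finset.sum_mul]
  exact Finset.sum_congr rfl fun γ _ => by ring

/-- A matrix is scalar if its off-diagonal entries vanish and its diagonal is constant. -/
theorem eq_smul_one_of_apply [DecidableEq κ] [Nonempty κ] {T : Matrix κ κ ℂ}
    (hoff : ∀ i j, i ≠ j → T i j = 0) (hdiag : ∀ i j, T i i = T j j) :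
    ∃ τ : ℂ, T = τ • 1 := by
  obtain ⟨i₀⟩ := ‹Nonempty κ›
  refine ⟨T i₀ i₀, ?_⟩
  ext i j
  rcases eq_or_ne i j with rfl | h
  · simp [hdiag i i₀]
  · simp [h, hoff i j h]

variable [Fintype ι] [Fintype κ]

/-- Multiplying a product operator on the left by any operator multiplies the middle factor of its
block trace on the left by a matrix not depending on that factor. -/
theorem exists_blockTrace_mul_kronecker (k : ι) (Q : Matrix (ι × κ × μ) (ι × κ × μ) ℂ)
    (E : Matrix ι ι ℂ) (N : Matrix μ μ ℂ) :
    ∃ Z : Matrix κ κ ℂ, ∀ M, blockTrace k (Q * (E ⊗ₖ (M ⊗ₖ N))) = Z * M := by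
  refine ⟨Matrix.of fun a c => ∑ γ, ∑ l, ∑ δ, Q (k, a, γ) (l, c, δ) * E l k * N δ γ, fun M => ?_⟩
  ext a b
  simp only [blockTrace, Matrix.of_apply, Matrix.mul_apply, Fintype.sum_prod_type,
    kroneckerMap_apply, Finset.sum_mul]
  conv_rhs => rw [Finset.sum_comm]
  refine Finset.sum_congr rfl fun γ _ => ?_
  conv_rhs => rw [Finset.sum_comm]
  exact Finset.sum_congr rfl fun l _ => Finset.sum_congr rfl fun c _ =>
    Finset.sum_congr rfl fun δ _ => by ring

theorem exists_blockTrace_kronecker_mul (k : ι) (Q : Matrix (ι × κ × μ) (ι × κ × μ) ℂ)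
    (E : Matrix ι ι ℂ) (N : Matrix μ μ ℂ) :
    ∃ W : Matrix κ κ ℂ, ∀ M, blockTrace k ((E ⊗ₖ (M ⊗ₖ N)) * Q) = M * W := by
  refine ⟨Matrix.of fun c b => ∑ γ, ∑ l, ∑ δ, E k l * N γ δ * Q (l, c, δ) (k, b, γ), fun M => ?_⟩
  ext a b
  simp only [blockTrace, Matrix.of_apply, Matrix.mul_apply, Fintype.sum_prod_type,
    kroneckerMap_apply, Finset.mul_sum]
  conv_rhs => rw [Finset.sum_comm]
  refine Finset.sum_congr rfl fun γ _ => ?_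
  conv_rhs => rw [Finset.sum_comm]
  exact Finset.sum_congr rfl fun l _ => Finset.sum_congr rfl fun c _ =>
    Finset.sum_congr rfl fun δ _ => by ring

/-- If conjugation by `T` is the sum of a left and a right multiplication, then `T` is scalar. -/
theorem eq_smul_one_of_forall_mul_conjTranspose [DecidableEq κ] [Nonempty κ]
    {T Z W : Matrix κ κ ℂ} (h : ∀ M, T * M * Tᴴ = Z * M + M * W) : ∃ τ : ℂ, T = τ • 1 := by
  have key : ∀ i j p q, T i j * star (T q p) =
      (if p = q then Z i j else 0) + if i = j then W p q else 0 := by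
    intro i j p q
    have := congrFun (congrFun (h (Matrix.single j p 1)) i) q
    simpa [Matrix.mul_apply, Matrix.single_apply, ite_and, eq_comm] using this
  refine eq_smul_one_of_apply (fun i j hij => ?_) fun i j => ?_
  · simpa [hij, hij.symm] using key i j j i
  · have h₁ := key i i i i
    have h₂ := key i i j j
    have h₃ := key j j i i
    have h₄ := key j j j j
    simp only [if_true] at h₁ h₂ h₃ h₄
    have : (T i i - T j j) * star (T i i - T j j) = 0 := by
      rw [star_sub]
      linear_combination h₁ - h₂ - h₃ + h₄
    exact sub_eq_zero.mp ((mul_eq_zero.mp this).elim id star_eq_zero.mp)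

/-- A matrix whose trace pairing with every traceless matrix vanishes is scalar. -/
theorem eq_smul_one_of_forall_trace_mul [DecidableEq μ] [Nonempty μ] {G : Matrix μ μ ℂ}
    (h : ∀ N : Matrix μ μ ℂ, N.trace = 0 → (G * N).trace = 0) : ∃ c : ℂ, G = c • 1 := by
  refine eq_smul_one_of_apply (fun i j hij => ?_) fun i j => ?_
  · simpa [Matrix.trace_mul_single] using
      h (Matrix.single j i 1) (Matrix.trace_single_eq_of_ne j i 1 hij.symm)
  · have := h (Matrix.single i i 1 - Matrix.single j j 1) (by simp)
    simpa [Matrix.mul_sub, Matrix.trace_mul_single, sub_eq_zero] using this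

theorem exists_pos_conjTranspose_mul_self_eq_smul_one [DecidableEq μ] {V : Matrix μ μ ℂ}
    (hV : V ≠ 0) (h : ∃ c : ℂ, Vᴴ * V = c • 1) : ∃ c : ℝ, 0 < c ∧ Vᴴ * V = (c : ℂ) • 1 := by
  obtain ⟨c, hc⟩ := h
  have hμ : Nonempty μ := by
    by_contra hμ
    rw [not_nonempty_iff] at hμ
    exact hV (Subsingleton.elim _ _)
  obtain ⟨i⟩ := hμ
  have hc₀ : 0 ≤ c := by
    simpa [hc] using (Matrix.posSemidef_conjTranspose_mul_self V).diag_nonneg (i := i)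
  have hc₁ : c ≠ 0 := by
    rintro rfl
    exact hV (by simpa using hc)
  obtain ⟨r, rfl⟩ : ∃ r : ℝ, c = r := ⟨c.re, Complex.eq_re_of_ofReal_le hc₀⟩
  exact ⟨r, lt_of_le_of_ne (by exact_mod_cast hc₀) fun h => hc₁ (by simp [← h]), hc⟩

/-- Evaluation of a traced block of a Lindblad-type expression on product operators `X`. -/
theorem mul_star_mul_trace_eq_zero [DecidableEq ι] [DecidableEq κ] [Nonempty κ]
    {S : Matrix ι ι ℂ} {T : Matrix κ κ ℂ} {V : Matrix μ μ ℂ}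
    {Q Q' R : Matrix (ι × κ × μ) (ι × κ × μ) ℂ} (hR : R = S ⊗ₖ (T ⊗ₖ V))
    (hT : ¬ ∃ τ : ℂ, T = τ • 1) (k l m : ι) (N : Matrix μ μ ℂ)
    (h : ∀ M : Matrix κ κ ℂ, ∀ X, X = Matrix.single l m 1 ⊗ₖ (M ⊗ₖ N) →
      blockTrace k (Q * X + X * Q' + R * X * Rᴴ) = 0) :
    S k l * star (S k m) * (Vᴴ * V * N).trace = 0 := by
  by_contra hs
  set s := S k l * star (S k m) * (Vᴴ * V * N).trace with hsdef
  obtain ⟨Z, hZ⟩ := exists_blockTrace_mul_kronecker k Q (Matrix.single l m 1) N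
  obtain ⟨W, hW⟩ := exists_blockTrace_kronecker_mul k Q' (Matrix.single l m 1) N
  refine hT (eq_smul_one_of_forall_mul_conjTranspose (Z := -s⁻¹ • Z) (W := -s⁻¹ • W) fun M => ?_)
  have hM := h M _ rfl
  have hs' : (S * Matrix.single l m (1 : ℂ) * Sᴴ) k k * (V * N * Vᴴ).trace = s := by
    rw [hsdef, Matrix.trace_mul_comm, ← Matrix.mul_assoc]
    simp [Matrix.mul_apply, Matrix.single_apply, ite_and]
  rw [blockTrace_add, blockTrace_add, hZ, hW, hR, conjTranspose_kronecker,
    conjTranspose_kronecker, ← mul_kronecker_mul, ← mul_kronecker_mul, ← mul_kronecker_mul,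
    ← mul_kronecker_mul, blockTrace_kronecker, hs'] at hM
  rw [smul_mul_assoc, mul_smul_comm, ← smul_add, eq_neg_of_add_eq_zero_left hM, smul_neg,
    neg_smul, neg_neg, smul_smul, inv_mul_cancel₀ hs, one_smul]

end


open Matrix ComplexOrder in
/-- Case (b) of Proposition 3: if `T` is not proportional to the identity, then `V` is
proportional to a unitary and every row of `S` has at most one non-zero entry. -/
theorem appendixB_case_b
    (n D₁ m₁ : ℕ) (hn : 1 ≤ n) (hD₁ : 1 ≤ D₁) (hm₁ : 1 ≤ m₁)
    (A : Matrix (Fin n) (Fin n) ℂ) (B : Matrix (Fin D₁) (Fin D₁) ℂ)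
    (C : Matrix (Fin m₁) (Fin m₁) ℂ)
    (hA : A.IsHermitian) (hB : B.IsHermitian) (hC : C.IsHermitian)
    (S : Matrix (Fin n) (Fin n) ℂ) (T : Matrix (Fin D₁) (Fin D₁) ℂ)
    (V : Matrix (Fin m₁) (Fin m₁) ℂ)
    (H R : Matrix (Fin n × Fin D₁ × Fin m₁) (Fin n × Fin D₁ × Fin m₁) ℂ)
    (hH : ∀ p q : Fin n × Fin D₁ × Fin m₁,
      H p q = A p.1 q.1 * B p.2.1 q.2.1 * C p.2.2 q.2.2)
    (hR : ∀ p q : Fin n × Fin D₁ × Fin m₁,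
      R p q = S p.1 q.1 * T p.2.1 q.2.1 * V p.2.2 q.2.2)
    (Q : Matrix (Fin n × Fin D₁ × Fin m₁) (Fin n × Fin D₁ × Fin m₁) ℂ)
    (hQ : Q = -Complex.I • H - ((1 : ℂ) / 2) • (Rᴴ * R))
    (Lmap : Matrix (Fin n × Fin D₁ × Fin m₁) (Fin n × Fin D₁ × Fin m₁) ℂ →
      Matrix (Fin n × Fin D₁ × Fin m₁) (Fin n × Fin D₁ × Fin m₁) ℂ)
    (hLmap : ∀ X, Lmap X = Q * X + X * Qᴴ + R * X * Rᴴ)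
    (σ : Fin n → Matrix (Fin m₁) (Fin m₁) ℂ)
    (hσpos : ∀ k, (σ k).PosDef) (hσtr : ∀ k, (σ k).trace = 1)
    (Pmap : Matrix (Fin n × Fin D₁ × Fin m₁) (Fin n × Fin D₁ × Fin m₁) ℂ →
      Matrix (Fin n × Fin D₁ × Fin m₁) (Fin n × Fin D₁ × Fin m₁) ℂ)
    (hPmap : ∀ (X : Matrix (Fin n × Fin D₁ × Fin m₁) (Fin n × Fin D₁ × Fin m₁) ℂ)
      (p q : Fin n × Fin D₁ × Fin m₁),
      Pmap X p q = if p.1 = q.1 then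
        σ p.1 p.2.2 q.2.2 * (∑ γ, X (p.1, p.2.1, γ) (p.1, q.2.1, γ)) else 0)
    (hPLP : ∀ X, Pmap (Lmap X) = Pmap (Lmap (Pmap X)))
    (hS0 : S ≠ 0) (hV0 : V ≠ 0) (hT : ¬ ∃ τ : ℂ, T = τ • 1) :
    (∃ c : ℝ, 0 < c ∧ Vᴴ * V = (c : ℂ) • 1) ∧
      (∀ k l m, l ≠ m → S k l = 0 ∨ S k m = 0) := by
  have : NeZero D₁ := ⟨by omega⟩
  have : NeZero m₁ := ⟨by omega⟩
  have hR' : R = kronecker S (kronecker T V) := by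
    ext p q
    simp [hR, kronecker, kroneckerMap_apply, mul_assoc]
  have key : ∀ k l m N, l ≠ m ∨ N.trace = 0 →
      S k l * star (S k m) * (Vᴴ * V * N).trace = 0 := by
    intro k l m N hlm
    refine mul_star_mul_trace_eq_zero (Q := Q) (Q' := Qᴴ) hR' hT k l m N fun M X hX => ?_
    have hPX : Pmap X = 0 := by
      ext p q
      rw [hPmap]
      split_ifs with hpq
      · change _ * blockTrace p.1 X p.2.1 q.2.1 = 0
        rw [hX, blockTrace_kronecker]
        rcases hlm with hlm | hN
        · have : Matrix.single l m (1 : ℂ) p.1 p.1 = 0 := by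
            rw [Matrix.single_apply, if_neg]
            rintro ⟨rfl, rfl⟩
            exact hlm rfl
          simp [this]
        · simp [hN]
      · rfl
    have hP₀ : Pmap 0 = 0 := by
      ext p q
      simp [hPmap]
    have hPL : Pmap (Lmap X) = 0 := by
      rw [hPLP, hPX, hLmap]
      simpa using hP₀
    ext a b
    have hab := congrFun (congrFun hPL (k, a, 0)) (k, b, 0)
    rw [hPmap, if_pos rfl, hLmap] at hab
    exact (mul_eq_zero.mp hab).resolve_left ((hσpos k).diag_pos (i := 0)).ne'
  constructor
  · refine exists_pos_conjTranspose_mul_self_eq_smul_one hV0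
      (eq_smul_one_of_forall_trace_mul fun N hN => ?_)
    obtain ⟨k, l, hkl⟩ : ∃ k l, S k l ≠ 0 := by
      by_contra! h
      exact hS0 (Matrix.ext h)
    simpa [hkl] using key k l l N (Or.inr hN)
  · intro k l m hlm
    have htr : (Vᴴ * V).trace ≠ 0 := by
      rwa [Ne, Matrix.trace_conjTranspose_mul_self_eq_zero_iff]
    simpa [htr] using key k l m 1 (Or.inl hlm)
end

section
/- With the setup and standing assumptions of the Appendix-B characterisation (in particular 𝒫(ℒ(X)) = 𝒫(ℒ(𝒫(X))) for all X), assume in addition that S ≠ 0, T ≠ 0, and that V is not proportional to a unitary (¬∃ c : ℝ, Vᴴ*V = (c : ℂ) • I). Then T is a scalar multiple of the identity (∃ τ ∈ ℂ, T = τ • I), and S is diagonal (S_{k,l} = 0 for all k ≠ l). -/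
namespace BlockObservable

open scoped Matrix ComplexOrder

variable {κ δ μ : Type*} [DecidableEq κ] [DecidableEq μ]

/-- The block-diagonal observable `⊕ k, y k ⊗ 1`. -/
def embed (y : κ → Matrix δ δ ℂ) : Matrix (κ × δ × μ) (κ × δ × μ) ℂ :=
  fun p q => if p.1 = q.1 ∧ p.2.2 = q.2.2 then y p.1 p.2.1 q.2.1 else 0

lemma embed_conjTranspose (y : κ → Matrix δ δ ℂ) :
    (embed y : Matrix (κ × δ × μ) (κ × δ × μ) ℂ)ᴴ = embed fun k => (y k)ᴴ := by
  ext p q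
  by_cases h : p.1 = q.1 ∧ p.2.2 = q.2.2
  · simp [embed, h.1, h.2]
  · have h2 : ¬ (q.1 = p.1 ∧ q.2.2 = p.2.2) := fun g => h ⟨g.1.symm, g.2.symm⟩
    simp [embed, h, h2]

lemma embed_add (y z : κ → Matrix δ δ ℂ) :
    (embed (y + z) : Matrix (κ × δ × μ) (κ × δ × μ) ℂ) = embed y + embed z := by
  ext p q
  by_cases h : p.1 = q.1 ∧ p.2.2 = q.2.2 <;> simp [embed, h]

lemma embed_sub (y z : κ → Matrix δ δ ℂ) :
    (embed (y - z) : Matrix (κ × δ × μ) (κ × δ × μ) ℂ) = embed y - embed z := by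
  ext p q
  by_cases h : p.1 = q.1 ∧ p.2.2 = q.2.2 <;> simp [embed, h]

lemma embed_one [DecidableEq δ] :
    (embed 1 : Matrix (κ × δ × μ) (κ × δ × μ) ℂ) = 1 := by
  ext ⟨k, a, α⟩ ⟨l, b, β⟩
  simp only [embed, Matrix.one_apply, Prod.mk.injEq, Pi.one_apply]
  grind

variable [Fintype μ]

/-- The conditional expectation onto `⊕ k, M_δ ⊗ σ k`. -/
def project (σ : κ → Matrix μ μ ℂ) (X : Matrix (κ × δ × μ) (κ × δ × μ) ℂ) :
    Matrix (κ × δ × μ) (κ × δ × μ) ℂ :=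
  fun p q => if p.1 = q.1 then
    σ p.1 p.2.2 q.2.2 * ∑ γ, X (p.1, p.2.1, γ) (p.1, q.2.1, γ) else 0

lemma project_single [DecidableEq δ] (σ : κ → Matrix μ μ ℂ) (p q : κ × δ × μ) (γ₀ : μ) :
    project σ (Matrix.single p q 1) = if p.1 = q.1 ∧ p.2.2 = q.2.2 then
      project σ (Matrix.single (p.1, p.2.1, γ₀) (p.1, q.2.1, γ₀) 1) else 0 := by
  obtain ⟨k, a, α⟩ := p
  obtain ⟨l, b, β⟩ := q
  have key (r c d) : ∑ γ, (Matrix.single (k, a, α) (l, b, β) (1 : ℂ)) (r, c, γ) (r, d, γ) =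
      if (k = l ∧ α = β) ∧ k = r ∧ a = c ∧ b = d then 1 else 0 := by
    simp only [Matrix.single_apply, Prod.mk.injEq]
    rw [Finset.sum_eq_single α (by grind) (by simp)]
    grind
  have key' (r c d) : ∑ γ, (Matrix.single (k, a, γ₀) (k, b, γ₀) (1 : ℂ)) (r, c, γ) (r, d, γ) =
      if k = r ∧ a = c ∧ b = d then 1 else 0 := by
    simp only [Matrix.single_apply, Prod.mk.injEq]
    rw [Finset.sum_eq_single γ₀ (by grind) (by simp)]
    grind
  by_cases h : k = l ∧ α = β
  · rw [if_pos h]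
    ext r s
    simp only [project, key, key', eq_true h, true_and]
  · rw [if_neg h]
    ext r s
    simp only [project, key, h, false_and, if_false, mul_zero, ite_self, Matrix.zero_apply]

variable [Fintype κ] [Fintype δ]

lemma embed_mul_apply (y : κ → Matrix δ δ ℂ) (X : Matrix (κ × δ × μ) (κ × δ × μ) ℂ)
    (p q : κ × δ × μ) :
    (embed y * X : Matrix (κ × δ × μ) (κ × δ × μ) ℂ) p q =
      ∑ c, y p.1 p.2.1 c * X (p.1, c, p.2.2) q := by
  simp only [Matrix.mul_apply, embed, Fintype.sum_prod_type, ite_and, ite_mul, zero_mul]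
  rw [Finset.sum_eq_single p.1 (by simp +contextual [eq_comm]) (by simp)]
  simp

lemma mul_embed_apply (y : κ → Matrix δ δ ℂ) (X : Matrix (κ × δ × μ) (κ × δ × μ) ℂ)
    (p q : κ × δ × μ) :
    (X * embed y : Matrix (κ × δ × μ) (κ × δ × μ) ℂ) p q =
      ∑ c, X p (q.1, c, q.2.2) * y q.1 c q.2.1 := by
  simp only [Matrix.mul_apply, embed, Fintype.sum_prod_type, ite_and, mul_ite, mul_zero]
  rw [Finset.sum_eq_single q.1 (by simp +contextual) (by simp)]
  simp

lemma embed_mul (y z : κ → Matrix δ δ ℂ) :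
    (embed (y * z) : Matrix (κ × δ × μ) (κ × δ × μ) ℂ) = embed y * embed z := by
  ext p q
  rw [embed_mul_apply]
  by_cases h : p.1 = q.1 ∧ p.2.2 = q.2.2 <;> simp [embed, h, Matrix.mul_apply]

lemma trace_embed_mul (y : κ → Matrix δ δ ℂ) (X : Matrix (κ × δ × μ) (κ × δ × μ) ℂ) :
    (embed y * X).trace =
      ∑ k, ∑ a, ∑ c, y k a c * ∑ γ, X (k, c, γ) (k, a, γ) := by
  simp only [Matrix.trace, Matrix.diag_apply, embed_mul_apply, Fintype.sum_prod_type,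
    Finset.mul_sum]
  refine Finset.sum_congr rfl fun k _ => Finset.sum_congr rfl fun a _ => ?_
  exact Finset.sum_comm

lemma trace_embed_mul_project {σ : κ → Matrix μ μ ℂ} (hσ : ∀ k, (σ k).trace = 1)
    (y : κ → Matrix δ δ ℂ) (X : Matrix (κ × δ × μ) (κ × δ × μ) ℂ) :
    (embed y * project σ X).trace = (embed y * X).trace := by
  rw [trace_embed_mul, trace_embed_mul]
  have h (k : κ) : ∑ γ, σ k γ γ = 1 := hσ k
  simp [project, ← Finset.sum_mul, h]

lemma eq_embed_of_trace_mul_project [DecidableEq δ] [Nonempty μ] (σ : κ → Matrix μ μ ℂ)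
    (Z : Matrix (κ × δ × μ) (κ × δ × μ) ℂ)
    (hZ : ∀ X, (Z * X).trace = (Z * project σ X).trace) :
    ∃ y, Z = embed y := by
  obtain ⟨γ₀⟩ := ‹Nonempty μ›
  refine ⟨fun k a b => Z (k, a, γ₀) (k, b, γ₀), ?_⟩
  have entry (p q) : Z p q = (Z * project σ (Matrix.single q p 1)).trace := by
    rw [← hZ, Matrix.trace_mul_single]; simp
  ext p q
  rw [entry, project_single σ q p γ₀]
  by_cases h : p.1 = q.1 ∧ p.2.2 = q.2.2
  · rw [if_pos ⟨h.1.symm, h.2.symm⟩]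
    simp only [embed, if_pos h]
    rw [entry, h.1]
  · rw [if_neg fun g => h ⟨g.1.symm, g.2.symm⟩]
    simp [embed, h]

lemma adjoint_embed [DecidableEq δ] [Nonempty μ] {σ : κ → Matrix μ μ ℂ}
    (hσ : ∀ k, (σ k).trace = 1) {Q R : Matrix (κ × δ × μ) (κ × δ × μ) ℂ}
    (hL : ∀ X, project σ (Q * X + X * Qᴴ + R * X * Rᴴ) =
      project σ (Q * project σ X + project σ X * Qᴴ + R * project σ X * Rᴴ))
    (y : κ → Matrix δ δ ℂ) :
    ∃ z, Qᴴ * embed y + embed y * Q + Rᴴ * embed y * R = embed z := by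
  refine eq_embed_of_trace_mul_project σ _ fun X => ?_
  have dual (X : Matrix (κ × δ × μ) (κ × δ × μ) ℂ) :
      ((Qᴴ * embed y + embed y * Q + Rᴴ * embed y * R) * X).trace =
      (embed y * (Q * X + X * Qᴴ + R * X * Rᴴ)).trace := by
    simp only [add_mul, mul_add, Matrix.trace_add]
    have h1 : (Qᴴ * embed y * X).trace = (embed y * (X * Qᴴ)).trace := by
      rw [Matrix.mul_assoc, Matrix.trace_mul_comm, Matrix.mul_assoc]
    have h2 : (Rᴴ * embed y * R * X).trace = (embed y * (R * X * Rᴴ)).trace := by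
      rw [Matrix.mul_assoc, Matrix.mul_assoc, Matrix.trace_mul_comm]
      simp only [Matrix.mul_assoc]
    rw [h1, h2, Matrix.mul_assoc]
    ring
  rw [dual, dual, ← trace_embed_mul_project hσ, hL, trace_embed_mul_project hσ]

/-- The carré du champ of an observable is again an observable. -/
lemma commutator_sq_embed [DecidableEq δ] [Nonempty μ] {σ : κ → Matrix μ μ ℂ}
    (hσ : ∀ k, (σ k).trace = 1) {Q R : Matrix (κ × δ × μ) (κ × δ × μ) ℂ}
    (hL : ∀ X, project σ (Q * X + X * Qᴴ + R * X * Rᴴ) =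
      project σ (Q * project σ X + project σ X * Qᴴ + R * project σ X * Rᴴ))
    (y : κ → Matrix δ δ ℂ) :
    ∃ z, (R * embed y - embed y * R)ᴴ * (R * embed y - embed y * R) = embed z := by
  set y' : κ → Matrix δ δ ℂ := fun k => (y k)ᴴ with hy'
  obtain ⟨z₁, h₁⟩ := adjoint_embed hσ hL (y' * y)
  obtain ⟨z₂, h₂⟩ := adjoint_embed hσ hL y'
  obtain ⟨z₃, h₃⟩ := adjoint_embed hσ hL y
  obtain ⟨z₄, h₄⟩ := adjoint_embed hσ hL 1
  refine ⟨z₁ - z₂ * y - y' * z₃ + y' * z₄ * y, ?_⟩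
  simp only [embed_add, embed_sub, embed_mul, ← h₁, ← h₂, ← h₃, ← h₄, embed_one,
    Matrix.conjTranspose_sub, Matrix.conjTranspose_mul, embed_conjTranspose, ← hy']
  noncomm_ring

lemma commutator_apply {S : Matrix κ κ ℂ} {T : Matrix δ δ ℂ} {V : Matrix μ μ ℂ}
    {R : Matrix (κ × δ × μ) (κ × δ × μ) ℂ}
    (hR : ∀ p q, R p q = S p.1 q.1 * T p.2.1 q.2.1 * V p.2.2 q.2.2)
    (y : κ → Matrix δ δ ℂ) (p q : κ × δ × μ) :
    (R * embed y - embed y * R : Matrix (κ × δ × μ) (κ × δ × μ) ℂ) p q =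
      S p.1 q.1 * (T * y q.1 - y p.1 * T) p.2.1 q.2.1 * V p.2.2 q.2.2 := by
  rw [Matrix.sub_apply, mul_embed_apply, embed_mul_apply, Matrix.sub_apply,
    Matrix.mul_apply, Matrix.mul_apply, mul_sub, sub_mul, Finset.mul_sum, Finset.mul_sum,
    Finset.sum_mul, Finset.sum_mul]
  congr 1 <;> exact Finset.sum_congr rfl fun c _ => by rw [hR]; ring

/-- If `Gᴴ * G ⊗ Vᴴ * V` is an observable and `V` is not proportional to a unitary,
then `G = 0`. -/
lemma eq_zero_of_sq_eq_embed [Nonempty μ] {V : Matrix μ μ ℂ}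
    (hV : ¬ ∃ c : ℝ, Vᴴ * V = (c : ℂ) • 1) {Z : Matrix (κ × δ × μ) (κ × δ × μ) ℂ}
    {G : κ → κ → δ → δ → ℂ}
    (hZ : ∀ p q, Z p q = G p.1 q.1 p.2.1 q.2.1 * V p.2.2 q.2.2)
    {z : κ → Matrix δ δ ℂ} (hz : Zᴴ * Z = embed z) (k l : κ) (a b : δ) :
    G k l a b = 0 := by
  obtain ⟨γ₀⟩ := ‹Nonempty μ›
  set g : ℂ := ∑ j, ∑ c, star (G j l c b) * G j l c b with hg
  have entry (α β : μ) : g * (Vᴴ * V) α β = if α = β then z l b b else 0 := by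
    have := congrFun (congrFun hz (l, b, α)) (l, b, β)
    simp only [embed, true_and] at this
    rw [← this]
    simp only [Matrix.mul_apply, Matrix.conjTranspose_apply, hZ, Fintype.sum_prod_type, star_mul']
    rw [hg, Finset.sum_mul]
    refine Finset.sum_congr rfl fun j _ => ?_
    rw [Finset.sum_mul]
    refine Finset.sum_congr rfl fun c _ => ?_
    rw [Finset.mul_sum]
    exact Finset.sum_congr rfl fun γ _ => by ring
  have g_zero : g = 0 := by
    by_contra hne
    refine hV ⟨((Vᴴ * V) γ₀ γ₀).re, ?_⟩
    have real : ((((Vᴴ * V) γ₀ γ₀).re : ℝ) : ℂ) = (Vᴴ * V) γ₀ γ₀ :=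
      (Matrix.isHermitian_conjTranspose_mul_self V).coe_re_apply_self γ₀
    rw [real]
    ext α β
    apply mul_left_cancel₀ hne
    rw [entry, Matrix.smul_apply, Matrix.one_apply]
    split_ifs with h
    · simpa using (entry γ₀ γ₀).symm
    · simp
  have nonneg (j : κ) (c : δ) : 0 ≤ star (G j l c b) * G j l c b := star_mul_self_nonneg _
  rw [hg, Finset.sum_eq_zero_iff_of_nonneg fun j _ => Finset.sum_nonneg fun c _ => nonneg j c]
    at g_zero
  have := (Finset.sum_eq_zero_iff_of_nonneg fun c _ => nonneg k c).1
    (g_zero k (Finset.mem_univ _)) a (Finset.mem_univ _)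
  simpa using this

end BlockObservable

open Matrix ComplexOrder in
/-- Case (c) of Proposition 3: if `V` is not proportional to a unitary, then `T` is a
scalar multiple of the identity and `S` is diagonal. -/
theorem appendixB_case_c
    (n D₁ m₁ : ℕ) (hn : 1 ≤ n) (hD₁ : 1 ≤ D₁) (hm₁ : 1 ≤ m₁)
    (A : Matrix (Fin n) (Fin n) ℂ) (B : Matrix (Fin D₁) (Fin D₁) ℂ)
    (C : Matrix (Fin m₁) (Fin m₁) ℂ)
    (hA : A.IsHermitian) (hB : B.IsHermitian) (hC : C.IsHermitian)
    (S : Matrix (Fin n) (Fin n) ℂ) (T : Matrix (Fin D₁) (Fin D₁) ℂ)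
    (V : Matrix (Fin m₁) (Fin m₁) ℂ)
    (H R : Matrix (Fin n × Fin D₁ × Fin m₁) (Fin n × Fin D₁ × Fin m₁) ℂ)
    (hH : ∀ p q : Fin n × Fin D₁ × Fin m₁,
      H p q = A p.1 q.1 * B p.2.1 q.2.1 * C p.2.2 q.2.2)
    (hR : ∀ p q : Fin n × Fin D₁ × Fin m₁,
      R p q = S p.1 q.1 * T p.2.1 q.2.1 * V p.2.2 q.2.2)
    (Q : Matrix (Fin n × Fin D₁ × Fin m₁) (Fin n × Fin D₁ × Fin m₁) ℂ)
    (hQ : Q = -Complex.I • H - ((1 : ℂ) / 2) • (Rᴴ * R))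
    (Lmap : Matrix (Fin n × Fin D₁ × Fin m₁) (Fin n × Fin D₁ × Fin m₁) ℂ →
      Matrix (Fin n × Fin D₁ × Fin m₁) (Fin n × Fin D₁ × Fin m₁) ℂ)
    (hLmap : ∀ X, Lmap X = Q * X + X * Qᴴ + R * X * Rᴴ)
    (σ : Fin n → Matrix (Fin m₁) (Fin m₁) ℂ)
    (hσpos : ∀ k, (σ k).PosDef) (hσtr : ∀ k, (σ k).trace = 1)
    (Pmap : Matrix (Fin n × Fin D₁ × Fin m₁) (Fin n × Fin D₁ × Fin m₁) ℂ →
      Matrix (Fin n × Fin D₁ × Fin m₁) (Fin n × Fin D₁ × Fin m₁) ℂ)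
    (hPmap : ∀ (X : Matrix (Fin n × Fin D₁ × Fin m₁) (Fin n × Fin D₁ × Fin m₁) ℂ)
      (p q : Fin n × Fin D₁ × Fin m₁),
      Pmap X p q = if p.1 = q.1 then
        σ p.1 p.2.2 q.2.2 * (∑ γ, X (p.1, p.2.1, γ) (p.1, q.2.1, γ)) else 0)
    (hPLP : ∀ X, Pmap (Lmap X) = Pmap (Lmap (Pmap X)))
    (hS0 : S ≠ 0) (hT0 : T ≠ 0) (hV : ¬ ∃ c : ℝ, Vᴴ * V = (c : ℂ) • 1) :
    (∃ τ : ℂ, T = τ • 1) ∧ (∀ k l, k ≠ l → S k l = 0) := by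
  have : NeZero m₁ := ⟨by omega⟩
  obtain rfl : Pmap = BlockObservable.project σ := by
    funext X
    ext p q
    exact hPmap X p q
  have comm (y : Fin n → Matrix (Fin D₁) (Fin D₁) ℂ) (k l : Fin n) :
      S k l • (T * y l - y k * T) = 0 := by
    obtain ⟨z, hz⟩ := BlockObservable.commutator_sq_embed hσtr
      (fun X => by rw [← hLmap, ← hLmap]; exact hPLP X) y
    ext a b
    exact BlockObservable.eq_zero_of_sq_eq_embed hV
      (G := fun k l a b => S k l * (T * y l - y k * T) a b)
      (BlockObservable.commutator_apply hR y) hz k l a b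
  have diag : ∀ k l, k ≠ l → S k l = 0 := fun k l hkl => by
    simpa [hkl, hT0] using comm (Pi.single l 1) k l
  refine ⟨?_, diag⟩
  obtain ⟨k, hk⟩ : ∃ k, S k k ≠ 0 := by
    by_contra! h
    refine hS0 (Matrix.ext fun k l => ?_)
    obtain rfl | hkl := eq_or_ne k l
    exacts [h k, diag k l hkl]
  have central (y : Matrix (Fin D₁) (Fin D₁) ℂ) : Commute y T :=
    (sub_eq_zero.1 ((smul_eq_zero.1 (comm (fun _ => y) k k)).resolve_left hk)).symm
  obtain ⟨τ, hτ⟩ := Matrix.mem_range_scalar_of_commute_single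
    fun i j _ => central (Matrix.single i j 1)
  exact ⟨τ, by rw [← hτ, Matrix.scalar_apply, Matrix.smul_one_eq_diagonal]⟩
end
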